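/- For x ∈ ℚ, define the colored structure polynomial φ(x) = Σ_{π ∈ G_{r,n}} b(x − des(π))·π ∈ ℚ[G_{r,n}], where b(z) = (1/n!)·∏_{m=1}^{n} (z + m) (the polynomial form of binomial(z + n, n)). Then for all x, y ∈ ℚ, φ(x)·φ(y) = φ(r·x·y + x + y). -/

import Mathlib

open scoped BigOperators

/-- Lexicographic (color-first) strict order on colored letters `(value, color)`. -/
def letterLT (x y : ℕ × ℕ) : Prop :=
  x.2 < y.2 ∨ (x.2 = y.2 ∧ x.1 < y.1)

instance : DecidableRel letterLT := fun x y => by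
  unfold letterLT; infer_instance

/-- The colored permutation group `G_{r,n}`. -/
@[ext] structure ColoredPerm (r n : ℕ) where
  perm : Equiv.Perm (Fin n)
  col : Fin n → ZMod r

namespace ColoredPerm

variable {r n : ℕ}

instance : Mul (ColoredPerm r n) :=
  ⟨fun a b => ⟨a.perm * b.perm, fun i => a.col (b.perm i) + b.col i⟩⟩

instance : One (ColoredPerm r n) :=
  ⟨⟨1, fun _ => 0⟩⟩

instance : Inv (ColoredPerm r n) :=
  ⟨fun a => ⟨a.perm⁻¹, fun i => -a.col (a.perm⁻¹ i)⟩⟩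

instance : Group (ColoredPerm r n) where
  mul_assoc a b c := by
    refine ColoredPerm.ext (mul_assoc _ _ _) ?_
    funext i
    show a.col (b.perm (c.perm i)) + b.col (c.perm i) + c.col i
        = a.col ((b.perm * c.perm) i) + (b.col (c.perm i) + c.col i)
    rw [Equiv.Perm.mul_apply, add_assoc]
  one_mul a := by
    refine ColoredPerm.ext (one_mul _) ?_
    funext i
    show (0 : ZMod r) + a.col i = a.col i
    rw [zero_add]
  mul_one a := by
    refine ColoredPerm.ext (mul_one _) ?_
    funext i
    show a.col ((1 : Equiv.Perm (Fin n)) i) + 0 = a.col i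
    simp
  inv_mul_cancel a := by
    refine ColoredPerm.ext (inv_mul_cancel _) ?_
    funext i
    show -a.col (a.perm⁻¹ (a.perm i)) + a.col i = 0
    simp

/-- `ColoredPerm r n` is equivalent (as a type) to a product. -/
def toProd : ColoredPerm r n ≃ Equiv.Perm (Fin n) × (Fin n → ZMod r) where
  toFun a := (a.perm, a.col)
  invFun p := ⟨p.1, p.2⟩
  left_inv _ := rfl
  right_inv _ := rfl

instance [NeZero r] : Fintype (ColoredPerm r n) := Fintype.ofEquiv _ toProd.symm

instance : DecidableEq (ColoredPerm r n) := toProd.decidableEq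

/-- The `i`-th letter of the one-line notation (0-indexed), as a pair (value, color);
for `i = n` this is the sentinel letter `0₁`. Values are in `{1, …, n}`. -/
def letterAt (a : ColoredPerm r n) (i : ℕ) : ℕ × ℕ :=
  if h : i < n then ((a.perm ⟨i, h⟩ : ℕ) + 1, (a.col ⟨i, h⟩).val) else (0, 1)

/-- The descent set of a colored permutation (positions 0-indexed: position `i`
corresponds to the paper's `i+1 ∈ {1, …, n}`). -/
def Des (a : ColoredPerm r n) : Finset (Fin n) :=
  Finset.univ.filter fun i : Fin n => letterLT (letterAt a (i.1 + 1)) (letterAt a i.1)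

/-- The descent number. -/
def des (a : ColoredPerm r n) : ℕ := (Des a).card

/-- The internal descent number `|Des(π) ∩ {1, …, n−1}|`. -/
def intdes (a : ColoredPerm r n) : ℕ :=
  ((Des a).filter fun i : Fin n => i.1 + 1 < n).card

end ColoredPerm

open ColoredPerm

/-- `b(z) = (1/n!) ∏_{m=1}^{n} (z + m)`, the polynomial form of `binomial(z+n, n)`. -/
noncomputable def bpoly (n : ℕ) (z : ℚ) : ℚ :=
  (∏ m ∈ Finset.Icc 1 n, (z + (m : ℚ))) / (n.factorial : ℚ)

/-- The colored structure polynomial `φ(x) = Σ_{π ∈ G_{r,n}} b(x − des(π))·π`. -/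
noncomputable def structurePoly (r n : ℕ) [NeZero r] (x : ℚ) :
    MonoidAlgebra ℚ (ColoredPerm r n) :=
  ∑ π : ColoredPerm r n,
    bpoly n (x - (des π : ℚ)) • MonoidAlgebra.of ℚ (ColoredPerm r n) π

namespace ColoredPerm

variable {r n : ℕ}

theorem mul_add_lt_mul_add_iff {a b c d : ℕ} (hc : c < r) (hd : d < r) :
    r * a + c < r * b + d ↔ a < b ∨ a = b ∧ c < d := by
  rcases lt_trichotomy a b with h | rfl | h
  · have := Nat.mul_le_mul_left r (Nat.succ_le_of_lt h)
    rw [Nat.mul_succ] at this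
    constructor
    · intro _; exact Or.inl h
    · intro _; omega
  · simp
  · have := Nat.mul_le_mul_left r (Nat.succ_le_of_lt h)
    rw [Nat.mul_succ] at this
    constructor
    · intro _; omega
    · rintro (h' | ⟨h', _⟩) <;> omega

theorem mem_Des_iff_of_lt (π : ColoredPerm r n) {s : ℕ} (hs : s + 1 < n) :
    (⟨s, by omega⟩ : Fin n) ∈ Des π ↔
      (π.col ⟨s + 1, hs⟩).val < (π.col ⟨s, by omega⟩).val ∨
      (π.col ⟨s + 1, hs⟩).val = (π.col ⟨s, by omega⟩).val ∧
        π.perm ⟨s + 1, hs⟩ < π.perm ⟨s, by omega⟩ := by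
  simp [Des, letterLT, letterAt, hs]

theorem mem_Des_iff_of_eq (π : ColoredPerm r n) {s : ℕ} (hs : s < n) (hsn : s + 1 = n) :
    (⟨s, hs⟩ : Fin n) ∈ Des π ↔ 0 < (π.col ⟨s, hs⟩).val := by
  have hs' : ¬ s + 1 < n := by omega
  rw [Des, Finset.mem_filter, letterAt, letterAt, dif_pos hs, dif_neg hs', letterLT]
  simp only [Finset.mem_univ, true_and]
  omega

/-- The number of non-descents of `π` at (0-indexed) positions before `s`. -/
def ascentsBefore (π : ColoredPerm r n) (s : ℕ) : ℕ :=
  (Finset.univ.filter fun t : Fin n => t.1 < s ∧ t ∉ Des π).card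

theorem ascentsBefore_succ (π : ColoredPerm r n) {s : ℕ} (hs : s < n) :
    ascentsBefore π (s + 1) = ascentsBefore π s + if (⟨s, hs⟩ : Fin n) ∈ Des π then 0 else 1 := by
  unfold ascentsBefore
  split_ifs with h
  · rw [add_zero]
    congr 1
    ext t
    simp only [Finset.mem_filter, Finset.mem_univ, true_and, and_congr_left_iff]
    intro ht
    have : t.1 ≠ s := by rintro rfl; exact ht h
    omega
  · rw [← Finset.card_insert_of_notMem (a := (⟨s, hs⟩ : Fin n)) (by simp)]
    congr 1
    ext t
    simp only [Finset.mem_filter, Finset.mem_univ, true_and, Finset.mem_insert]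
    constructor
    · rintro ⟨h1, h2⟩
      by_cases h3 : t.1 = s
      · exact Or.inl (Fin.ext h3)
      · exact Or.inr ⟨by omega, h2⟩
    · rintro (rfl | ⟨h1, h2⟩)
      · exact ⟨Nat.lt_succ_self _, h⟩
      · exact ⟨by omega, h2⟩

theorem ascentsBefore_le (π : ColoredPerm r n) {s : ℕ} (hs : s ≤ n) : ascentsBefore π s ≤ s := by
  induction s with
  | zero => simp [ascentsBefore]
  | succ s ih =>
    rw [ascentsBefore_succ π hs]
    have := ih (by omega)
    split_ifs <;> omega

theorem ascentsBefore_self_add_des (π : ColoredPerm r n) : ascentsBefore π n + des π = n := by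
  have h := Finset.card_filter_add_card_filter_not (s := (Finset.univ : Finset (Fin n)))
    (fun t => t ∉ Des π)
  simpa [ascentsBefore, des] using h

/-- The colored permutation that sorts the word `f` (ties broken by position), colored by the
residues of its entries. -/
def standardize (r : ℕ) (f : Fin n → ℕ) : ColoredPerm r n :=
  ⟨Tuple.sort f, fun s => (f (Tuple.sort f s) : ZMod r)⟩

theorem standardize_eq_iff {f : Fin n → ℕ} {π : ColoredPerm r n} :
    standardize r f = π ↔
      (∀ s t, s < t → f (π.perm s) < f (π.perm t) ∨
        f (π.perm s) = f (π.perm t) ∧ π.perm s < π.perm t) ∧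
      ∀ s, (f (π.perm s) : ZMod r) = π.col s := by
  have key : (∀ s t, s < t → f (π.perm s) < f (π.perm t) ∨
      f (π.perm s) = f (π.perm t) ∧ π.perm s < π.perm t) ↔ π.perm = Tuple.sort f := by
    rw [Tuple.eq_sort_iff]
    constructor
    · intro h
      refine ⟨fun s t hst => ?_, fun s t hst he => ?_⟩
      · rcases hst.eq_or_lt with rfl | hst
        · exact le_rfl
        · rcases h s t hst with h | h
          · exact h.le
          · exact h.1.le
      · rcases h s t hst with h | h
        · omega
        · exact h.2
    · rintro ⟨hm, ht⟩ s t hst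
      rcases (hm hst.le).lt_or_eq with h | h
      · exact Or.inl h
      · exact Or.inr ⟨h, ht s t hst h⟩
  rw [key]
  constructor
  · rintro rfl
    exact ⟨rfl, fun _ => rfl⟩
  · rintro ⟨h1, h2⟩
    refine ColoredPerm.ext h1.symm ?_
    funext s
    rw [← h2, h1]
    rfl

theorem standardize_mul (r M : ℕ) (hM : (M : ZMod r) = 1) (f g : Fin n → ℕ) (hf : ∀ v, f v < M) :
    standardize r f * standardize r g =
      standardize r fun v => f v + M * g ((Tuple.sort f).symm v) := by
  symm
  have hF := (standardize_eq_iff (r := r) (f := f)).1 rfl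
  have hG := (standardize_eq_iff (r := r) (f := g)).1 rfl
  rw [standardize_eq_iff]
  refine ⟨fun s t hst => ?_, fun s => ?_⟩
  · change f (Tuple.sort f (Tuple.sort g s)) +
        M * g ((Tuple.sort f).symm (Tuple.sort f (Tuple.sort g s))) <
        f (Tuple.sort f (Tuple.sort g t)) +
        M * g ((Tuple.sort f).symm (Tuple.sort f (Tuple.sort g t))) ∨
      f (Tuple.sort f (Tuple.sort g s)) +
        M * g ((Tuple.sort f).symm (Tuple.sort f (Tuple.sort g s))) =
        f (Tuple.sort f (Tuple.sort g t)) +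
        M * g ((Tuple.sort f).symm (Tuple.sort f (Tuple.sort g t))) ∧
      Tuple.sort f (Tuple.sort g s) < Tuple.sort f (Tuple.sort g t)
    simp only [Equiv.symm_apply_apply]
    rcases hG.1 s t hst with h | ⟨h, h'⟩
    · left
      change g (Tuple.sort g s) < g (Tuple.sort g t) at h
      have := (mul_add_lt_mul_add_iff (hf (Tuple.sort f (Tuple.sort g s)))
        (hf (Tuple.sort f (Tuple.sort g t)))).2 (Or.inl h)
      omega
    · change g (Tuple.sort g s) = g (Tuple.sort g t) at h
      rw [h]
      rcases hF.1 _ _ h' with h | ⟨h, h'⟩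
      · exact Or.inl (Nat.add_lt_add_right h _)
      · exact Or.inr ⟨congrArg (· + M * g (Tuple.sort g t)) h, h'⟩
  · change ((f (Tuple.sort f (Tuple.sort g s)) +
        M * g ((Tuple.sort f).symm (Tuple.sort f (Tuple.sort g s))) : ℕ) : ZMod r) =
      (f (Tuple.sort f (Tuple.sort g s)) : ZMod r) + (g (Tuple.sort g s) : ZMod r)
    simp [hM]

/-- If `f` standardizes to `π`, then the quotients of `f` by `r`, read along `π`, increase weakly,
and strictly at the descents of `π`. -/
theorem div_add_le_of_standardize_eq [NeZero r] {f : Fin n → ℕ} {π : ColoredPerm r n}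
    (h : standardize r f = π) {s : ℕ} (hs : s + 1 < n) :
    f (π.perm ⟨s, by omega⟩) / r + (if (⟨s, by omega⟩ : Fin n) ∈ Des π then 1 else 0) ≤
      f (π.perm ⟨s + 1, hs⟩) / r := by
  obtain ⟨h1, h2⟩ := standardize_eq_iff.1 h
  have hr : 0 < r := Nat.pos_of_neZero r
  have hv : ∀ s, f (π.perm s) % r = (π.col s).val := fun s => by
    rw [← h2 s, ZMod.val_natCast]
  have hd := mem_Des_iff_of_lt π hs
  have h3 := h1 ⟨s, by omega⟩ ⟨s + 1, hs⟩ (by simp [Fin.lt_def])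
  rw [← hv, ← hv] at hd
  set a := f (π.perm ⟨s, by omega⟩)
  set b := f (π.perm ⟨s + 1, hs⟩)
  have h4 := mul_add_lt_mul_add_iff (a := a / r) (b := b / r) (Nat.mod_lt a hr) (Nat.mod_lt b hr)
  rw [Nat.div_add_mod, Nat.div_add_mod] at h4
  rcases h3 with h3 | ⟨h3, h5⟩
  · rcases h4.1 h3 with h6 | ⟨h6, h7⟩
    · split_ifs <;> omega
    · rw [if_neg]
      · omega
      · rw [hd]; omega
  · rw [if_neg, h3]
    · simp
    · rw [hd, h3]
      rintro (h | h)
      · omega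
      · exact lt_asymm h5 h.2

theorem div_add_le_of_le [NeZero r] {f : Fin n → ℕ} {π : ColoredPerm r n} {x : ℕ}
    (h : standardize r f = π) (hx : ∀ v, f v ≤ r * x) {s : ℕ} (hs : s < n) (hsn : s + 1 = n) :
    f (π.perm ⟨s, hs⟩) / r + (if (⟨s, hs⟩ : Fin n) ∈ Des π then 1 else 0) ≤ x := by
  obtain ⟨-, h2⟩ := standardize_eq_iff.1 h
  have hr : 0 < r := Nat.pos_of_neZero r
  have hd := mem_Des_iff_of_eq π hs hsn
  rw [← h2, ZMod.val_natCast] at hd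
  have h3 := hx (π.perm ⟨s, hs⟩)
  set a := f (π.perm ⟨s, hs⟩)
  have h4 := mul_add_lt_mul_add_iff (a := x) (b := a / r) hr (Nat.mod_lt a hr)
  rw [Nat.div_add_mod] at h4
  have h5 : ¬ (x < a / r ∨ x = a / r ∧ 0 < a % r) := by rw [← h4]; omega
  split_ifs with h6
  · have := hd.1 h6
    omega
  · omega

theorem standardize_eq_of_add_le [NeZero r] {π : ColoredPerm r n} {q : Fin n → ℕ}
    (hq : ∀ s (hs : s + 1 < n),
      q ⟨s, by omega⟩ + (if (⟨s, by omega⟩ : Fin n) ∈ Des π then 1 else 0) ≤ q ⟨s + 1, hs⟩) :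
    standardize r (fun v => r * q (π.perm.symm v) + (π.col (π.perm.symm v)).val) = π := by
  rw [standardize_eq_iff]
  simp only [Equiv.symm_apply_apply]
  refine ⟨?_, fun s => by simp⟩
  have step : ∀ s t (hs : s < n) (ht : t < n), s < t →
      r * q ⟨s, hs⟩ + (π.col ⟨s, hs⟩).val < r * q ⟨t, ht⟩ + (π.col ⟨t, ht⟩).val ∨
      r * q ⟨s, hs⟩ + (π.col ⟨s, hs⟩).val = r * q ⟨t, ht⟩ + (π.col ⟨t, ht⟩).val ∧
        π.perm ⟨s, hs⟩ < π.perm ⟨t, ht⟩ := by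
    have base : ∀ s (hs : s + 1 < n),
      r * q ⟨s, by omega⟩ + (π.col ⟨s, by omega⟩).val <
        r * q ⟨s + 1, hs⟩ + (π.col ⟨s + 1, hs⟩).val ∨
      r * q ⟨s, by omega⟩ + (π.col ⟨s, by omega⟩).val =
        r * q ⟨s + 1, hs⟩ + (π.col ⟨s + 1, hs⟩).val ∧
        π.perm ⟨s, by omega⟩ < π.perm ⟨s + 1, hs⟩ := by
      intro s hs
      have hd := mem_Des_iff_of_lt π hs
      have h := hq s hs
      rw [mul_add_lt_mul_add_iff (ZMod.val_lt _) (ZMod.val_lt _)]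
      split_ifs at h with h'
      · left; left; omega
      · rw [hd, not_or] at h'
        rcases (show _ ≤ _ from h).lt_or_eq with h3 | h3
        · left; left; omega
        · rw [add_zero] at h3
          rw [h3]
          rcases lt_or_eq_of_le (not_lt.1 h'.1) with h4 | h4
          · exact Or.inl (Or.inr ⟨rfl, h4⟩)
          · right
            refine ⟨by rw [h4], ?_⟩
            have h5 : ¬ _ := fun h6 => h'.2 ⟨h4.symm, h6⟩
            refine lt_of_le_of_ne (not_lt.1 h5) fun h6 => ?_
            have := congrArg Fin.val (π.perm.injective h6)
            simp at this
    intro s t hs ht hst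
    induction t, hst using Nat.le_induction with
    | base => exact base s ht
    | succ t hst ih =>
      have h1 := ih (by omega)
      have h2 := base t ht
      rcases h1 with h1 | ⟨h1, h1'⟩ <;> rcases h2 with h2 | ⟨h2, h2'⟩
      · left; omega
      · left; omega
      · left; omega
      · right; exact ⟨h1.trans h2, h1'.trans h2'⟩
  intro s t hst
  exact step s t s.2 t.2 hst

theorem card_fin_orderEmbedding (n m : ℕ) : Nat.card (Fin n ↪o Fin m) = m.choose n := by
  rw [Nat.card_congr Set.powersetCard.ofFinEmbEquiv, Set.powersetCard.card]
  simp

theorem card_standardize_fiber [NeZero r] (π : ColoredPerm r n) (x : ℕ) :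
    Nat.card {f : Fin n → Fin (r * x + 1) // standardize r (fun v => (f v : ℕ)) = π} =
      (x + n - des π).choose n := by
  have hE := ascentsBefore_self_add_des π
  rw [← card_fin_orderEmbedding]
  have hmono : ∀ f : {f : Fin n → Fin (r * x + 1) // standardize r (fun v => (f v : ℕ)) = π},
      ∀ s t (hs : s < n) (ht : t < n), s < t →
      (f.1 (π.perm ⟨s, hs⟩) : ℕ) / r + ascentsBefore π s <
        (f.1 (π.perm ⟨t, ht⟩) : ℕ) / r + ascentsBefore π t := by
    intro f
    have base : ∀ s (hs : s + 1 < n),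
        (f.1 (π.perm ⟨s, by omega⟩) : ℕ) / r + ascentsBefore π s <
        (f.1 (π.perm ⟨s + 1, hs⟩) : ℕ) / r + ascentsBefore π (s + 1) := by
      intro s hs
      have h := div_add_le_of_standardize_eq f.2 hs
      rw [ascentsBefore_succ π (show s < n by omega)]
      split_ifs at h ⊢ <;> omega
    intro s t hs ht hst
    induction t, hst using Nat.le_induction with
    | base => exact base s ht
    | succ t hst ih =>
      have h1 := ih (by omega)
      exact h1.trans (base t ht)
  have hbound : ∀ f : {f : Fin n → Fin (r * x + 1) // standardize r (fun v => (f v : ℕ)) = π},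
      ∀ s : Fin n, (f.1 (π.perm s) : ℕ) / r + ascentsBefore π s < x + n - des π := by
    intro f s
    have hn : n - 1 < n := by have := s.2; omega
    have hl := div_add_le_of_le f.2 (fun v => Nat.lt_succ_iff.1 (f.1 v).2) hn (by omega)
    have h1 := ascentsBefore_succ π hn
    rw [show n - 1 + 1 = n by omega] at h1
    have h2 : (f.1 (π.perm ⟨n - 1, hn⟩) : ℕ) / r + ascentsBefore π (n - 1) < x + n - des π := by
      split_ifs at hl h1 <;> omega
    rcases (show s.1 ≤ n - 1 by omega).eq_or_lt with h | h
    · rw [show s = ⟨n - 1, hn⟩ from Fin.ext h]; exact h2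
    · exact (hmono f s (n - 1) s.2 hn h).trans h2
  refine Nat.card_congr (Equiv.ofBijective (fun f => OrderEmbedding.ofStrictMono
    (fun s => ⟨(f.1 (π.perm s) : ℕ) / r + ascentsBefore π s, hbound f s⟩)
    (fun s t hst => hmono f s t s.2 t.2 hst)) ⟨?_, ?_⟩)
  · intro f g hfg
    have hv : ∀ f : {f : Fin n → Fin (r * x + 1) // standardize r (fun v => (f v : ℕ)) = π},
        ∀ s, (f.1 (π.perm s) : ℕ) % r = (π.col s).val := fun f s => by
      rw [← (standardize_eq_iff.1 f.2).2 s, ZMod.val_natCast]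
    apply Subtype.ext
    funext v
    obtain ⟨s, rfl⟩ := π.perm.surjective v
    have h := congrArg Fin.val (DFunLike.congr_fun hfg s)
    change (f.1 (π.perm s) : ℕ) / r + ascentsBefore π s =
      (g.1 (π.perm s) : ℕ) / r + ascentsBefore π s at h
    apply Fin.ext
    rw [← Nat.div_add_mod (f.1 (π.perm s) : ℕ) r, ← Nat.div_add_mod (g.1 (π.perm s) : ℕ) r,
      hv f, hv g, Nat.add_right_cancel h]
  · intro k
    have hr : 0 < r := Nat.pos_of_neZero r
    have hk : ∀ s (hs : s < n), ascentsBefore π s ≤ k ⟨s, hs⟩ := by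
      intro s hs
      refine (ascentsBefore_le π hs.le).trans ?_
      induction s with
      | zero => exact Nat.zero_le _
      | succ s ih =>
        have h1 := ih (by omega)
        have h2 : k ⟨s, by omega⟩ < k ⟨s + 1, hs⟩ := k.strictMono (by simp [Fin.lt_def])
        rw [Fin.lt_def] at h2
        omega
    have hq : ∀ s (hs : s + 1 < n), ((k ⟨s, by omega⟩ : ℕ) - ascentsBefore π s) +
        (if (⟨s, by omega⟩ : Fin n) ∈ Des π then 1 else 0) ≤
          (k ⟨s + 1, hs⟩ : ℕ) - ascentsBefore π (s + 1) := by
      intro s hs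
      have h2 : k ⟨s, by omega⟩ < k ⟨s + 1, hs⟩ := k.strictMono (by simp [Fin.lt_def])
      rw [Fin.lt_def] at h2
      have h3 := hk s (by omega)
      rw [ascentsBefore_succ π (show s < n by omega)]
      split_ifs <;> omega
    have hst := standardize_eq_of_add_le (q := fun s => (k s : ℕ) - ascentsBefore π s) hq
    have hle : ∀ s : Fin n, r * ((k s : ℕ) - ascentsBefore π s) + (π.col s).val ≤ r * x := by
      intro s
      have hn : n - 1 < n := by have := s.2; omega
      have h1 := ascentsBefore_succ π hn
      have h2 := hk (n - 1) hn
      have h3 := (k ⟨n - 1, hn⟩).2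
      rw [show n - 1 + 1 = n by omega] at h1
      have hd := mem_Des_iff_of_eq π hn (by omega)
      have hlast : r * ((k ⟨n - 1, hn⟩ : ℕ) - ascentsBefore π (n - 1)) +
          (π.col ⟨n - 1, hn⟩).val ≤ r * x := by
        rw [← not_lt, ← add_zero (r * x), mul_add_lt_mul_add_iff hr (ZMod.val_lt _), ← hd]
        split_ifs at h1 with h4
        · omega
        · rintro (h5 | h5)
          · omega
          · exact h4 h5.2
      rcases (show s.1 ≤ n - 1 by omega).eq_or_lt with h | h
      · rw [show s = ⟨n - 1, hn⟩ from Fin.ext h]; exact hlast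
      · have h5 := (standardize_eq_iff.1 hst).1 s ⟨n - 1, hn⟩ h
        simp only [Equiv.symm_apply_apply] at h5
        omega
    refine ⟨⟨fun v => ⟨_, Nat.lt_succ_iff.2 (hle (π.perm.symm v))⟩, hst⟩, ?_⟩
    ext s
    have h := hk s s.2
    simp only [Fin.eta] at h
    change (r * ((k (π.perm.symm (π.perm s)) : ℕ) - ascentsBefore π (π.perm.symm (π.perm s))) +
      (π.col (π.perm.symm (π.perm s))).val) / r + ascentsBefore π s = k s
    rw [Equiv.symm_apply_apply, Nat.mul_add_div hr, Nat.div_eq_of_lt (ZMod.val_lt _)]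
    omega

theorem des_le (π : ColoredPerm r n) : des π ≤ n := by
  have := ascentsBefore_self_add_des π
  omega

end ColoredPerm

theorem bpoly_natCast (n m : ℕ) : bpoly n (m : ℚ) = ((m + n).choose n : ℚ) := by
  rw [bpoly, div_eq_iff (by positivity)]
  have h : ∏ j ∈ Finset.Icc 1 n, ((m : ℚ) + j) = ((m + 1).ascFactorial n : ℕ) := by
    rw [Nat.ascFactorial_eq_prod_range, ← Finset.Ico_add_one_right_eq_Icc,
      Finset.prod_Ico_eq_prod_range]
    push_cast
    exact Finset.prod_congr (by simp) fun _ _ => by ring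
  rw [h, Nat.ascFactorial_eq_factorial_mul_choose]
  push_cast
  ring

theorem bpoly_natCast_sub {n d : ℕ} (hd : d ≤ n) (x : ℕ) :
    bpoly n ((x : ℚ) - d) = ((x + n - d).choose n : ℚ) := by
  rcases le_or_gt d x with h | h
  · rw [← Nat.cast_sub h, bpoly_natCast, show x - d + n = x + n - d by omega]
  · rw [Nat.choose_eq_zero_of_lt (by omega), bpoly,
      Finset.prod_eq_zero (i := d - x) (by simp; omega)]
    · simp
    · rw [Nat.cast_sub h.le]; ring

theorem structurePoly_natCast (r n : ℕ) [NeZero r] (x : ℕ) :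
    structurePoly r n (x : ℚ) = ∑ f : Fin n → Fin (r * x + 1),
      MonoidAlgebra.of ℚ (ColoredPerm r n) (standardize r fun v => (f v : ℕ)) := by
  rw [← Finset.sum_fiberwise (g := fun f : Fin n → Fin (r * x + 1) =>
    standardize r fun v => (f v : ℕ)), structurePoly]
  refine Finset.sum_congr rfl fun π _ => ?_
  rw [Finset.sum_congr rfl (g := fun _ => MonoidAlgebra.of ℚ (ColoredPerm r n) π)
    (fun f hf => by rw [(Finset.mem_filter.1 hf).2]), Finset.sum_const,
    bpoly_natCast_sub (des_le π), ← card_standardize_fiber, Nat.cast_smul_eq_nsmul,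
    Nat.card_eq_fintype_card, Fintype.card_subtype]

theorem structurePoly_mul_natCast (r n : ℕ) [NeZero r] (x y : ℕ) :
    structurePoly r n (x : ℚ) * structurePoly r n (y : ℚ) =
      structurePoly r n ((r : ℚ) * x * y + x + y) := by
  rw [show (r : ℚ) * x * y + x + y = ((r * x * y + x + y : ℕ) : ℚ) by push_cast; ring]
  simp only [structurePoly_natCast]
  have hcard : (r * y + 1) * (r * x + 1) = r * (r * x * y + x + y) + 1 := by ring
  rw [← hcard, Finset.sum_mul_sum,
    ← Equiv.sum_comp (Equiv.arrowCongr (Equiv.refl (Fin n)) finProdFinEquiv),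
    ← Equiv.sum_comp (Equiv.arrowProdEquivProdArrow _ _ _).symm, Fintype.sum_prod_type_right]
  refine Finset.sum_congr rfl fun f _ => ?_
  rw [← Equiv.sum_comp (Equiv.arrowCongr (Tuple.sort fun v => (f v : ℕ)).symm (Equiv.refl _))]
  refine Finset.sum_congr rfl fun g _ => ?_
  rw [← map_mul, standardize_mul r (r * x + 1) (by simp) _ _ fun v => (f v).2]
  simp [Equiv.arrowCongr, Equiv.arrowProdEquivProdArrow]

/-- The polynomial `b(z)`. -/
noncomputable def bpolyPolynomial (n : ℕ) : Polynomial ℚ :=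
  Polynomial.C (n.factorial : ℚ)⁻¹ * ∏ m ∈ Finset.Icc 1 n, (Polynomial.X + Polynomial.C (m : ℚ))

theorem eval_bpolyPolynomial (n : ℕ) (z : ℚ) : (bpolyPolynomial n).eval z = bpoly n z := by
  simp [bpolyPolynomial, bpoly, Polynomial.eval_prod, div_eq_inv_mul]

theorem exists_polynomial_eval_eq_dual_structurePoly (r n : ℕ) [NeZero r]
    (L : MonoidAlgebra ℚ (ColoredPerm r n) →ₗ[ℚ] ℚ) (a b : ℚ) :
    ∃ p : Polynomial ℚ, ∀ x, p.eval x = L (structurePoly r n (a * x + b)) := by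
  refine ⟨∑ π : ColoredPerm r n, (bpolyPolynomial n).comp
    (Polynomial.C a * Polynomial.X + Polynomial.C b - Polynomial.C (des π : ℚ)) *
      Polynomial.C (L (MonoidAlgebra.of ℚ _ π)), fun x => ?_⟩
  simp [structurePoly, Polynomial.eval_finsetSum, eval_bpolyPolynomial, -MonoidAlgebra.of_apply]

theorem Polynomial.eval_eq_of_forall_natCast {p q : Polynomial ℚ}
    (h : ∀ k : ℕ, p.eval (k : ℚ) = q.eval (k : ℚ)) (x : ℚ) : p.eval x = q.eval x := by
  rw [Polynomial.eq_of_infinite_eval_eq p q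
    ((Set.infinite_range_of_injective Nat.cast_injective).mono (by rintro _ ⟨k, rfl⟩; exact h k))]

/-- For linear `T`, the identity `T (φ(x)) = φ(a x + b)` holds for all rational `x` once it holds
for natural `x`. -/
theorem structurePoly_map_eq_of_forall_natCast {r n : ℕ} [NeZero r] {a b : ℚ}
    (T : MonoidAlgebra ℚ (ColoredPerm r n) →ₗ[ℚ] MonoidAlgebra ℚ (ColoredPerm r n))
    (h : ∀ k : ℕ, T (structurePoly r n (k : ℚ)) = structurePoly r n (a * k + b)) (x : ℚ) :
    T (structurePoly r n x) = structurePoly r n (a * x + b) := by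
  rw [← sub_eq_zero, ← Module.forall_dual_apply_eq_zero_iff ℚ]
  intro L
  obtain ⟨p, hp⟩ := exists_polynomial_eval_eq_dual_structurePoly r n (L ∘ₗ T) 1 0
  obtain ⟨q, hq⟩ := exists_polynomial_eval_eq_dual_structurePoly r n L a b
  have hpq := Polynomial.eval_eq_of_forall_natCast (p := p) (q := q)
    (fun k => by simp [hp, hq, h]) x
  rw [map_sub, sub_eq_zero, ← hq, ← hpq, hp]
  simp

/-- `φ(x)·φ(y) = φ(rxy + x + y)` for all `x, y ∈ ℚ`. -/
theorem structurePoly_mul (r n : ℕ) [NeZero r] (hn : 1 ≤ n) (x y : ℚ) :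
    structurePoly r n x * structurePoly r n y =
      structurePoly r n ((r : ℚ) * x * y + x + y) := by
  have hnat (k : ℕ) : structurePoly r n x * structurePoly r n (k : ℚ) =
      structurePoly r n ((r * x + 1) * k + x) := by
    have h := structurePoly_map_eq_of_forall_natCast (a := r * k + 1) (b := k)
      (LinearMap.mulRight ℚ (structurePoly r n (k : ℚ))) (fun j => by
        rw [LinearMap.mulRight_apply, structurePoly_mul_natCast]
        congr 1
        ring) x
    rw [LinearMap.mulRight_apply] at h
    rw [h]
    congr 1
    ring
  have h := structurePoly_map_eq_of_forall_natCast
    (LinearMap.mulLeft ℚ (structurePoly r n x)) hnat y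
  rw [LinearMap.mulLeft_apply] at h
  rw [h]
  congr 1
  ring
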